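/- Let c* be the optimal value of the LIP and let f* be an optimal solution. Assume in addition that the linear operator φ is invertible. For any ε̄ ∈ (0, ε) with e(f*) ≤ ε̄², any η̂ > c*, and any η̄ ∈ (0, c*], the function η is α-strongly convex on Ĥ(ε̄, η̂) = {h ∈ B_c ∩ K(ε̄) : η(h) ≤ η̂} with α = (2·η̄³/(‖x‖² − ε²)) · λ̄(φᵃ∘φ), where λ̄(φᵃ∘φ) is the minimum eigenvalue of φᵃ∘φ; that is, η(h') ≥ η(h) + ⟨∇η(h), h' − h⟩ + (α/2)·‖h' − h‖² for all h, h' ∈ Ĥ(ε̄, η̂). -/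

import Mathlib

open scoped RealInnerProductSpace

noncomputable section

/- The function `e(h) = min_θ ‖x - θ·φ(h)‖²`. -/
open Classical in
def eFun {H : Type*} [NormedAddCommGroup H] [InnerProductSpace ℝ H] {n : ℕ}
    (φ : H →ₗ[ℝ] EuclideanSpace ℝ (Fin n)) (x : EuclideanSpace ℝ (Fin n)) (h : H) : ℝ :=
  if φ h = 0 then ‖x‖ ^ 2 else ‖x‖ ^ 2 - (⟪x, φ h⟫) ^ 2 / ‖φ h‖ ^ 2

/- The convex cone `K(ε̄) = {h : ⟨x, φ h⟩ > 0 and e(h) ≤ ε̄²}`. -/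
def Kcone {H : Type*} [NormedAddCommGroup H] [InnerProductSpace ℝ H] {n : ℕ}
    (φ : H →ₗ[ℝ] EuclideanSpace ℝ (Fin n)) (x : EuclideanSpace ℝ (Fin n)) (ebar : ℝ) :
    Set H :=
  {h | 0 < ⟪x, φ h⟫ ∧ eFun φ x h ≤ ebar ^ 2}

/- The objective `η(h) = (‖x‖² - ε²)/(⟨x, φ h⟩ + ‖φ h‖·√(ε² - e(h)))`. -/
def etaFun {H : Type*} [NormedAddCommGroup H] [InnerProductSpace ℝ H] {n : ℕ}
    (φ : H →ₗ[ℝ] EuclideanSpace ℝ (Fin n)) (x : EuclideanSpace ℝ (Fin n)) (ε : ℝ)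
    (h : H) : ℝ :=
  (‖x‖ ^ 2 - ε ^ 2) / (⟪x, φ h⟫ + ‖φ h‖ * Real.sqrt (ε ^ 2 - eFun φ x h))

/-- Quadratic lower bound for the smaller root `t` of `‖x - t • y‖ ^ 2 = ‖x‖ ^ 2 - M` as a
function of `y`. -/
theorem smaller_root_add_sq_le {E : Type*} [NormedAddCommGroup E] [InnerProductSpace ℝ E]
    {x y y' : E} {t t' s M m : ℝ} (ht : 0 < t) (ht' : 0 < t') (hs : 0 < s) (hm : 0 ≤ m)
    (hmt : m ≤ t) (hmt' : m ≤ t') (hM : 0 < M) (hsy : ⟪x, y⟫ - t * ‖y‖ ^ 2 = s)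
    (hroot : t ^ 2 * ‖y‖ ^ 2 - 2 * t * ⟪x, y⟫ + M = 0)
    (hroot' : t' ^ 2 * ‖y'‖ ^ 2 - 2 * t' * ⟪x, y'⟫ + M = 0) :
    t - t * (⟪x, y' - y⟫ - t * ⟪y, y' - y⟫) / s + m ^ 3 / M * ‖y' - y‖ ^ 2 ≤ t' := by
  have hcs : ⟪y, t' • y' - t • y⟫ ^ 2 ≤ ‖y‖ ^ 2 * ‖t' • y' - t • y‖ ^ 2 := by
    rw [← mul_pow, ← sq_abs]
    exact pow_le_pow_left₀ (abs_nonneg _) (abs_real_inner_le_norm _ _) 2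
  have hD : ‖t' • y' - t • y‖ ^ 2
      = t' ^ 2 * ‖y'‖ ^ 2 - 2 * t * t' * ⟪y, y'⟫ + t ^ 2 * ‖y‖ ^ 2 := by
    rw [norm_sub_sq_real, norm_smul, norm_smul, real_inner_smul_left, real_inner_smul_right,
      mul_pow, mul_pow, Real.norm_eq_abs, Real.norm_eq_abs, sq_abs, sq_abs, real_inner_comm]
    ring
  have hG : ⟪y, t' • y' - t • y⟫ = t' * ⟪y, y'⟫ - t * ‖y‖ ^ 2 := by
    rw [inner_sub_right, real_inner_smul_right, real_inner_smul_right, real_inner_self_eq_norm_sq]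
  have hw : ‖y' - y‖ ^ 2 = ‖y'‖ ^ 2 - 2 * ⟪y, y'⟫ + ‖y‖ ^ 2 := by
    rw [norm_sub_sq_real, real_inner_comm]
  have hp : ⟪x, y' - y⟫ - t * ⟪y, y' - y⟫
      = ⟪x, y'⟫ - ⟪x, y⟫ - t * (⟪y, y'⟫ - ‖y‖ ^ 2) := by
    rw [inner_sub_right, inner_sub_right, real_inner_self_eq_norm_sq]
  have hw0 := sq_nonneg ‖y' - y‖
  rw [hp]
  generalize ‖t' • y' - t • y‖ ^ 2 = D at *
  generalize ⟪y, t' • y' - t • y⟫ = G at *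
  generalize ‖y' - y‖ ^ 2 = W at *
  generalize ‖y‖ ^ 2 = b at *
  generalize ‖y'‖ ^ 2 = b' at *
  generalize ⟪y, y'⟫ = k at *
  generalize ⟪x, y⟫ = a at *
  generalize ⟪x, y'⟫ = a' at *
  have hm3 : m ^ 3 ≤ t ^ 2 * t' := by
    calc m ^ 3 = m ^ 2 * m := by ring
      _ ≤ t ^ 2 * t' := by gcongr
  have hMs : M = 2 * t * s + t ^ 2 * b := by subst hsy; linarith
  have hexp : t' - t + t * (a' - a - t * (k - b)) / s
      = ((t' - t) ^ 2 + t * D / (2 * s)) / t' := by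
    field_simp
    subst hsy
    rw [hD]
    linear_combination (-t) * hroot' + t * hroot
  have hquad : 0 ≤ t * (4 * s ^ 2 * (t' - t) ^ 2 + t ^ 2 * b * D + 4 * s * t * (t' - t) * G) := by
    refine mul_nonneg ht.le ?_
    nlinarith [sq_nonneg (2 * s * (t' - t) + t * G), mul_le_mul_of_nonneg_left hcs (sq_nonneg t)]
  have hW : t' ^ 2 * W = D - 2 * (t' - t) * G + (t' - t) ^ 2 * b := by
    rw [hw, hD, hG]; ring
  have hkey : t ^ 2 * t' / M * W ≤ ((t' - t) ^ 2 + t * D / (2 * s)) / t' := by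
    have h1 : t ^ 2 * (t' ^ 2 * W) * (2 * s) ≤ M * (2 * s * (t' - t) ^ 2 + t * D) := by
      rw [hW, hMs]; linarith
    have h2 : ((t' - t) ^ 2 + t * D / (2 * s)) / t' - t ^ 2 * t' / M * W
        = (M * (2 * s * (t' - t) ^ 2 + t * D) - t ^ 2 * (t' ^ 2 * W) * (2 * s))
          / (2 * s * t' * M) := by
      field_simp
    have h3 := div_nonneg (sub_nonneg.2 h1) (by positivity : 0 ≤ 2 * s * t' * M)
    linarith
  have hle : m ^ 3 / M * W ≤ t ^ 2 * t' / M * W := by gcongr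
  linarith

/-- The smallest eigenvalue of `φᵃ ∘ φ` bounds `‖φ d‖ ^ 2 / ‖d‖ ^ 2` from below. -/
theorem isLeast_eigenvalue_mul_norm_sq_le {H E : Type*} [NormedAddCommGroup H]
    [InnerProductSpace ℝ H] [FiniteDimensional ℝ H] [NormedAddCommGroup E]
    [InnerProductSpace ℝ E] [FiniteDimensional ℝ E] {φ : H →ₗ[ℝ] E} {l : ℝ}
    (hl : IsLeast {μ : ℝ | Module.End.HasEigenvalue ((LinearMap.adjoint φ) ∘ₗ φ) μ} l) (d : H) :
    l * ‖d‖ ^ 2 ≤ ‖φ d‖ ^ 2 := by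
  rcases eq_or_ne d 0 with rfl | hd
  · simp
  have : Nontrivial H := ⟨⟨d, 0, hd⟩⟩
  have hinner (v : H) : ⟪((LinearMap.adjoint φ) ∘ₗ φ) v, v⟫ = ‖φ v‖ ^ 2 := by
    rw [LinearMap.comp_apply, LinearMap.adjoint_inner_left, real_inner_self_eq_norm_sq]
  have hsymm : ((LinearMap.adjoint φ) ∘ₗ φ).IsSymmetric := fun v w => by
    rw [LinearMap.comp_apply, LinearMap.comp_apply, LinearMap.adjoint_inner_left,
      LinearMap.adjoint_inner_right]
  have hle := hl.2 hsymm.hasEigenvalue_iInf_of_finiteDimensional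
  have hbdd : BddBelow (Set.range fun v : { v : H // v ≠ 0 } =>
      (RCLike.re ⟪((LinearMap.adjoint φ) ∘ₗ φ) v, (v : H)⟫ / ‖(v : H)‖ ^ 2 : ℝ)) := by
    refine ⟨0, ?_⟩
    rintro _ ⟨v, rfl⟩
    simp only [hinner, RCLike.re_to_real]
    positivity
  have h2 := hle.trans (ciInf_le hbdd ⟨d, hd⟩)
  simp only [hinner, RCLike.re_to_real] at h2
  rwa [le_div_iff₀ (by positivity)] at h2

section EtaFun

variable {H : Type*} [NormedAddCommGroup H] [InnerProductSpace ℝ H] {n : ℕ}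
  {φ : H →ₗ[ℝ] EuclideanSpace ℝ (Fin n)} {x : EuclideanSpace ℝ (Fin n)} {ε ebar : ℝ}

theorem norm_sq_mul_sub_eFun (h : H) :
    ‖φ h‖ ^ 2 * (ε ^ 2 - eFun φ x h)
      = ⟪x, φ h⟫ ^ 2 - (‖x‖ ^ 2 - ε ^ 2) * ‖φ h‖ ^ 2 := by
  by_cases h0 : φ h = 0
  · simp [h0]
  · have : ‖φ h‖ ≠ 0 := norm_ne_zero_iff.2 h0
    rw [eFun, if_neg h0]
    field_simp
    ring

theorem etaFun_eq (h : H) :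
    etaFun φ x ε h = (‖x‖ ^ 2 - ε ^ 2)
      / (⟪x, φ h⟫ + √(⟪x, φ h⟫ ^ 2 - (‖x‖ ^ 2 - ε ^ 2) * ‖φ h‖ ^ 2)) := by
  rw [etaFun, ← norm_sq_mul_sub_eFun, Real.sqrt_mul (sq_nonneg _), Real.sqrt_sq (norm_nonneg _)]

theorem discrim_pos_of_mem_Kcone (hebar : 0 ≤ ebar) (hε : ebar < ε) {h : H}
    (hh : h ∈ Kcone φ x ebar) :
    0 < ⟪x, φ h⟫ ^ 2 - (‖x‖ ^ 2 - ε ^ 2) * ‖φ h‖ ^ 2 := by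
  have h0 : φ h ≠ 0 := fun h0 => by simpa [h0] using hh.1
  rw [← norm_sq_mul_sub_eFun]
  have : ebar ^ 2 < ε ^ 2 := pow_lt_pow_left₀ hε hebar two_ne_zero
  exact mul_pos (pow_pos (norm_pos_iff.2 h0) 2) (by linarith [hh.2])

theorem etaFun_pos (hM : 0 < ‖x‖ ^ 2 - ε ^ 2) {h : H} (hh : 0 < ⟪x, φ h⟫) :
    0 < etaFun φ x ε h := by
  rw [etaFun_eq]
  positivity

theorem inner_sub_etaFun_mul {h : H} (hh : 0 < ⟪x, φ h⟫)
    (hdisc : 0 < ⟪x, φ h⟫ ^ 2 - (‖x‖ ^ 2 - ε ^ 2) * ‖φ h‖ ^ 2) :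
    ⟪x, φ h⟫ - etaFun φ x ε h * ‖φ h‖ ^ 2
      = √(⟪x, φ h⟫ ^ 2 - (‖x‖ ^ 2 - ε ^ 2) * ‖φ h‖ ^ 2) := by
  rw [etaFun_eq]
  have hsq := Real.sq_sqrt hdisc.le
  have hs := Real.sqrt_pos.2 hdisc
  set s := √(⟪x, φ h⟫ ^ 2 - (‖x‖ ^ 2 - ε ^ 2) * ‖φ h‖ ^ 2)
  have : ⟪x, φ h⟫ + s ≠ 0 := by positivity
  field_simp
  linear_combination -hsq

theorem etaFun_root {h : H} (hh : 0 < ⟪x, φ h⟫)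
    (hdisc : 0 < ⟪x, φ h⟫ ^ 2 - (‖x‖ ^ 2 - ε ^ 2) * ‖φ h‖ ^ 2) :
    etaFun φ x ε h ^ 2 * ‖φ h‖ ^ 2 - 2 * etaFun φ x ε h * ⟪x, φ h⟫ + (‖x‖ ^ 2 - ε ^ 2) = 0 := by
  have h1 := inner_sub_etaFun_mul hh hdisc
  have h2 : etaFun φ x ε h
      * (⟪x, φ h⟫ + √(⟪x, φ h⟫ ^ 2 - (‖x‖ ^ 2 - ε ^ 2) * ‖φ h‖ ^ 2)) = ‖x‖ ^ 2 - ε ^ 2 := by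
    rw [etaFun_eq]
    exact div_mul_cancel₀ _ (by positivity)
  rw [← h1] at h2
  linear_combination -h2

theorem norm_sub_etaFun_smul (hε : 0 ≤ ε) {h : H} (hh : 0 < ⟪x, φ h⟫)
    (hdisc : 0 < ⟪x, φ h⟫ ^ 2 - (‖x‖ ^ 2 - ε ^ 2) * ‖φ h‖ ^ 2) :
    ‖x - φ (etaFun φ x ε h • h)‖ = ε := by
  rw [← pow_left_inj₀ (norm_nonneg _) hε two_ne_zero, map_smul, norm_sub_sq_real,
    real_inner_smul_right, norm_smul, mul_pow, Real.norm_eq_abs, sq_abs]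
  linear_combination etaFun_root hh hdisc

theorem inner_gradient_etaFun [FiniteDimensional ℝ H] {h : H} (hh : 0 < ⟪x, φ h⟫)
    (hdisc : 0 < ⟪x, φ h⟫ ^ 2 - (‖x‖ ^ 2 - ε ^ 2) * ‖φ h‖ ^ 2) (d : H) :
    ⟪gradient (etaFun φ x ε) h, d⟫
      = -(etaFun φ x ε h * (⟪x, φ d⟫ - etaFun φ x ε h * ⟪φ h, φ d⟫)
        / √(⟪x, φ h⟫ ^ 2 - (‖x‖ ^ 2 - ε ^ 2) * ‖φ h‖ ^ 2)) := by
  have hφ : HasFDerivAt (fun g => φ g) (LinearMap.toContinuousLinearMap φ) h :=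
    (LinearMap.toContinuousLinearMap φ).hasFDerivAt
  have ha := (hasFDerivAt_const x h).inner ℝ hφ
  have hden : ⟪x, φ h⟫ + √(⟪x, φ h⟫ ^ 2 - (‖x‖ ^ 2 - ε ^ 2) * ‖φ h‖ ^ 2) ≠ 0 := by positivity
  have hf := ((hasDerivAt_inv hden).comp_hasFDerivAt h (ha.fun_add
    (((ha.pow 2).fun_sub (hφ.norm_sq.const_mul (‖x‖ ^ 2 - ε ^ 2))).sqrt
      hdisc.ne'))).const_mul (‖x‖ ^ 2 - ε ^ 2)
  have heq : etaFun φ x ε = fun g => (‖x‖ ^ 2 - ε ^ 2)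
      * (⟪x, φ g⟫ + √(⟪x, φ g⟫ ^ 2 - (‖x‖ ^ 2 - ε ^ 2) * ‖φ g‖ ^ 2))⁻¹ :=
    funext fun g => by rw [etaFun_eq, div_eq_mul_inv]
  have hf' : HasFDerivAt (etaFun φ x ε) _ h := heq ▸ hf
  rw [gradient, InnerProductSpace.toDual_symm_apply, etaFun_eq, hf'.fderiv]
  simp
  have hs := Real.sqrt_pos.2 hdisc
  set s := √(⟪x, φ h⟫ ^ 2 - (‖x‖ ^ 2 - ε ^ 2) * ‖φ h‖ ^ 2)
  field_simp
  ring

end EtaFun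

/- STATEMENT 6: if `φ` is invertible, `η` is `α`-strongly convex on
`Ĥ(ε̄, η̂) = {h ∈ B_c ∩ K(ε̄) : η(h) ≤ η̂}` with
`α = (2 η̄³/(‖x‖² - ε²))·λ̄(φᵃ∘φ)`. -/
theorem stmt6 {H : Type*} [NormedAddCommGroup H] [InnerProductSpace ℝ H]
    [FiniteDimensional ℝ H] {n : ℕ}
    (φ : H →ₗ[ℝ] EuclideanSpace ℝ (Fin n)) (x : EuclideanSpace ℝ (Fin n))
    (ε : ℝ) (hε : 0 < ε) (hx : ε < ‖x‖)
    (c : H → ℝ)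
    (hhom : ∀ r : ℝ, 0 ≤ r → ∀ f : H, c (r • f) = r * c f)
    (hcpt : IsCompact {f : H | c f ≤ 1})
    (hcvx : Convex ℝ {f : H | c f ≤ 1})
    (hfeas : ∃ f : H, ‖x - φ f‖ < ε)
    (hbij : Function.Bijective ⇑φ)
    (cstar : ℝ) (hcstar : IsLeast {y : ℝ | ∃ f : H, ‖x - φ f‖ ≤ ε ∧ c f = y} cstar)
    (fstar : H) (hf1 : ‖x - φ fstar‖ ≤ ε) (hf2 : c fstar = cstar)
    (ebar ηhat ηbar lambar : ℝ)
    (heb1 : 0 < ebar) (heb2 : ebar < ε) (heb3 : eFun φ x fstar ≤ ebar ^ 2)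
    (hηhat : cstar < ηhat) (hηbar1 : 0 < ηbar) (hηbar2 : ηbar ≤ cstar)
    (hlam : IsLeast
      {μ : ℝ | Module.End.HasEigenvalue ((LinearMap.adjoint φ) ∘ₗ φ) μ} lambar) :
    ∀ h ∈ {g : H | c g ≤ 1} ∩ Kcone φ x ebar ∩ {g : H | etaFun φ x ε g ≤ ηhat},
    ∀ h' ∈ {g : H | c g ≤ 1} ∩ Kcone φ x ebar ∩ {g : H | etaFun φ x ε g ≤ ηhat},
      etaFun φ x ε h' ≥
        etaFun φ x ε h + ⟪gradient (etaFun φ x ε) h, h' - h⟫ +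
          (2 * ηbar ^ 3 / (‖x‖ ^ 2 - ε ^ 2) * lambar) / 2 * ‖h' - h‖ ^ 2 := by
  rintro h ⟨⟨hc, hK⟩, -⟩ h' ⟨⟨hc', hK'⟩, -⟩
  have hM : 0 < ‖x‖ ^ 2 - ε ^ 2 := sub_pos.2 (pow_lt_pow_left₀ hx hε.le two_ne_zero)
  have hdisc := discrim_pos_of_mem_Kcone heb1.le heb2 hK
  have hdisc' := discrim_pos_of_mem_Kcone heb1.le heb2 hK'
  have hlb : ∀ g, c g ≤ 1 → g ∈ Kcone φ x ebar → ηbar ≤ etaFun φ x ε g := by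
    intro g hcg hKg
    have hpos := etaFun_pos hM hKg.1
    have hopt := hcstar.2 ⟨etaFun φ x ε g • g,
      (norm_sub_etaFun_smul hε.le hKg.1 (discrim_pos_of_mem_Kcone heb1.le heb2 hKg)).le, rfl⟩
    rw [hhom _ hpos.le] at hopt
    linarith [mul_le_of_le_one_right hpos.le hcg]
  have hmain := smaller_root_add_sq_le (etaFun_pos hM hK.1) (etaFun_pos hM hK'.1)
    (Real.sqrt_pos.2 hdisc) hηbar1.le (hlb h hc hK) (hlb h' hc' hK') hM
    (inner_sub_etaFun_mul hK.1 hdisc) (etaFun_root hK.1 hdisc) (etaFun_root hK'.1 hdisc')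
  rw [inner_gradient_etaFun hK.1 hdisc, map_sub]
  have hl := isLeast_eigenvalue_mul_norm_sq_le hlam (h' - h)
  rw [map_sub] at hl
  have hα := mul_le_mul_of_nonneg_left hl
    (by positivity : 0 ≤ ηbar ^ 3 / (‖x‖ ^ 2 - ε ^ 2))
  have hrw : (2 * ηbar ^ 3 / (‖x‖ ^ 2 - ε ^ 2) * lambar) / 2 * ‖h' - h‖ ^ 2
      = ηbar ^ 3 / (‖x‖ ^ 2 - ε ^ 2) * (lambar * ‖h' - h‖ ^ 2) := by ring
  rw [hrw]
  linarith
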